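/- arXiv:2506.19173 — 4 statements merged into one kernel-verified Lean document; each statement's English description precedes it below -/
import Mathlib

section
/- For every natural number c, the real number C(c) = (−6 + (15 − 7√3)(7 − 4√3)^c + (15 + 7√3)(7 + 4√3)^c)/4 is an integer; that is, there exists k ∈ ℤ with C(c) = k. -/
noncomputable def paperC (c : ℕ) : ℝ :=
  (-6 + (15 - 7 * Real.sqrt 3) * (7 - 4 * Real.sqrt 3) ^ c
      + (15 + 7 * Real.sqrt 3) * (7 + 4 * Real.sqrt 3) ^ c) / 4

/-- The conjugate terms of `paperC` are `(2k + 3) ± b√3` for integers `k` and `b`. -/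
theorem exists_int_conjugate_terms (c : ℕ) : ∃ k b : ℤ,
    (15 + 7 * Real.sqrt 3) * (7 + 4 * Real.sqrt 3) ^ c = (2 * k + 3) + b * Real.sqrt 3 ∧
    (15 - 7 * Real.sqrt 3) * (7 - 4 * Real.sqrt 3) ^ c = (2 * k + 3) - b * Real.sqrt 3 := by
  induction c with
  | zero => exact ⟨6, 7, by norm_num, by norm_num⟩
  | succ c ih =>
    obtain ⟨k, b, hadd, hsub⟩ := ih
    have hsq : Real.sqrt 3 * Real.sqrt 3 = 3 := Real.mul_self_sqrt (by norm_num)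
    refine ⟨7 * k + 6 * b + 9, 8 * k + 7 * b + 12, ?_, ?_⟩
    · rw [pow_succ, ← mul_assoc, hadd]
      push_cast
      linear_combination 4 * (b : ℝ) * hsq
    · rw [pow_succ, ← mul_assoc, hsub]
      push_cast
      linear_combination 4 * (b : ℝ) * hsq

theorem stmt_9 : ∀ c : ℕ, ∃ k : ℤ, paperC c = (k : ℝ) := by
  intro c
  obtain ⟨k, b, hadd, hsub⟩ := exists_int_conjugate_terms c
  refine ⟨k, ?_⟩
  rw [paperC, hadd, hsub]
  ring
end

section
/- For every natural number c, the real numbers C(c) and B(c) satisfy 9·C(c)² + 27·C(c) + 27 = 27·B(c)² + 243·B(c) + 729. -/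
noncomputable def paperB (c : ℕ) : ℝ :=
  (-18 + (7 - 5 * Real.sqrt 3) * (7 - 4 * Real.sqrt 3) ^ c
      + (7 + 5 * Real.sqrt 3) * (7 + 4 * Real.sqrt 3) ^ c) / 4

theorem stmt_11 : ∀ c : ℕ,
    9 * paperC c ^ 2 + 27 * paperC c + 27 = 27 * paperB c ^ 2 + 243 * paperB c + 729 := by
  intro c
  have hs : Real.sqrt 3 ^ 2 = 3 := Real.sq_sqrt (by norm_num)
  have huv : (7 - 4 * Real.sqrt 3) ^ c * (7 + 4 * Real.sqrt 3) ^ c = 1 := by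
    rw [← mul_pow, show (7 - 4 * Real.sqrt 3) * (7 + 4 * Real.sqrt 3) = 1 by
      linear_combination -16 * hs, one_pow]
  unfold paperC paperB
  generalize (7 - 4 * Real.sqrt 3) ^ c = u at huv ⊢
  generalize (7 + 4 * Real.sqrt 3) ^ c = v at huv ⊢
  linear_combination (-(9 / 16) * 26 * (u - v) ^ 2) * hs + (9 / 16 * 312) * huv
end

section
/- For every natural number c, the identity A(c)³ + B(c)³ = C(c)³ + D(c)³ holds, where A(c) = C(c) + 3 and D(c) = B(c) + 9. -/
noncomputable def paperA (c : ℕ) : ℝ := paperC c + 3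

noncomputable def paperD (c : ℕ) : ℝ := paperB c + 9

theorem sub_sqrt_three_pow_mul_add_sqrt_three_pow (c : ℕ) :
    (7 - 4 * Real.sqrt 3) ^ c * (7 + 4 * Real.sqrt 3) ^ c = 1 := by
  have hs : Real.sqrt 3 ^ 2 = 3 := Real.sq_sqrt (by norm_num)
  have h : (7 - 4 * Real.sqrt 3) * (7 + 4 * Real.sqrt 3) = 1 := by
    linear_combination -16 * hs
  rw [← mul_pow, h, one_pow]

theorem stmt_12 : ∀ c : ℕ,
    paperA c ^ 3 + paperB c ^ 3 = paperC c ^ 3 + paperD c ^ 3 := by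
  intro c
  have hs : Real.sqrt 3 ^ 2 = 3 := Real.sq_sqrt (by norm_num)
  have huv := sub_sqrt_three_pow_mul_add_sqrt_three_pow c
  unfold paperA paperD paperB paperC
  generalize (7 - 4 * Real.sqrt 3) ^ c = u at *
  generalize (7 + 4 * Real.sqrt 3) ^ c = v at *
  linear_combination (9 / 16) * (-26 * u ^ 2 - 26 * v ^ 2 + 52 * u * v) * hs
    + (9 / 16) * 312 * huv
end

section
/- The sequence C(c) is strictly increasing in c; consequently the symbolic generator produces infinitely many distinct integer quadruples (A(c), B(c), C(c), D(c)) satisfying A(c)³ + B(c)³ = C(c)³ + D(c)³. -/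
/-- Integer coordinates of the powers of the unit `7 + 4√3` and of its conjugate. -/
lemma exists_pell_coordinates (c : ℕ) : ∃ x y : ℤ, 0 < x ∧ 0 ≤ y ∧ x ^ 2 - 3 * y ^ 2 = 1 ∧
    (7 - 4 * √3 : ℝ) ^ c = x - y * √3 ∧ (7 + 4 * √3 : ℝ) ^ c = x + y * √3 := by
  have h3 : (√3 : ℝ) ^ 2 = 3 := Real.sq_sqrt (by norm_num)
  induction c with
  | zero => exact ⟨1, 0, by norm_num⟩
  | succ c ih =>
    obtain ⟨x, y, hx, hy, hxy, hm, hp⟩ := ih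
    refine ⟨7 * x + 12 * y, 4 * x + 7 * y, by omega, by omega, by linear_combination hxy, ?_, ?_⟩
    · rw [pow_succ, hm]
      push_cast
      linear_combination 4 * (y : ℝ) * h3
    · rw [pow_succ, hp]
      push_cast
      linear_combination 4 * (y : ℝ) * h3

lemma paperC_eq_of_pow_eq {c : ℕ} {x y : ℝ} (hm : (7 - 4 * √3) ^ c = x - y * √3)
    (hp : (7 + 4 * √3) ^ c = x + y * √3) : paperC c = (15 * x + 21 * y - 3) / 2 := by
  have h3 : (√3 : ℝ) ^ 2 = 3 := Real.sq_sqrt (by norm_num)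
  rw [paperC, hm, hp]
  linear_combination 7 / 2 * y * h3

lemma paperB_eq_of_pow_eq {c : ℕ} {x y : ℝ} (hm : (7 - 4 * √3) ^ c = x - y * √3)
    (hp : (7 + 4 * √3) ^ c = x + y * √3) : paperB c = (7 * x + 15 * y - 9) / 2 := by
  have h3 : (√3 : ℝ) ^ 2 = 3 := Real.sq_sqrt (by norm_num)
  rw [paperB, hm, hp]
  linear_combination 5 / 2 * y * h3

lemma paperC_strictMono : StrictMono paperC := by
  have h3 : (√3 : ℝ) ^ 2 = 3 := Real.sq_sqrt (by norm_num)
  refine strictMono_nat_of_lt_succ fun c => ?_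
  obtain ⟨x, y, hx, hy, -, hm, hp⟩ := exists_pell_coordinates c
  have hm' : (7 - 4 * √3 : ℝ) ^ (c + 1) = (7 * x + 12 * y) - (4 * x + 7 * y) * √3 := by
    rw [pow_succ, hm]
    linear_combination 4 * (y : ℝ) * h3
  have hp' : (7 + 4 * √3 : ℝ) ^ (c + 1) = (7 * x + 12 * y) + (4 * x + 7 * y) * √3 := by
    rw [pow_succ, hp]
    linear_combination 4 * (y : ℝ) * h3
  rw [paperC_eq_of_pow_eq hm hp, paperC_eq_of_pow_eq hm' hp']
  have hx' : (0 : ℝ) < x := by exact_mod_cast hx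
  have hy' : (0 : ℝ) ≤ y := by exact_mod_cast hy
  linarith

lemma exists_int_paperC_paperB (c : ℕ) :
    ∃ k b : ℤ, paperC c = k ∧ paperB c = b := by
  obtain ⟨x, y, -, -, hxy, hm, hp⟩ := exists_pell_coordinates c
  have hodd : Odd (x + y) := by
    have h : Odd (x ^ 2 - 3 * y ^ 2) := hxy ▸ odd_one
    simp only [Int.odd_sub, Int.odd_pow, Int.even_mul, Int.even_pow] at h
    rw [Int.odd_add]
    simpa [show ¬ Even (3 : ℤ) by decide] using h
  obtain ⟨t, ht⟩ := hodd
  have ht' : (x : ℝ) + y = 2 * t + 1 := by exact_mod_cast ht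
  refine ⟨15 * t + 3 * y + 6, 7 * t + 4 * y - 1, ?_, ?_⟩
  · rw [paperC_eq_of_pow_eq hm hp]
    push_cast
    linear_combination 15 / 2 * ht'
  · rw [paperB_eq_of_pow_eq hm hp]
    push_cast
    linear_combination 7 / 2 * ht'

lemma paperA_cube_add_paperB_cube (c : ℕ) :
    paperA c ^ 3 + paperB c ^ 3 = paperC c ^ 3 + paperD c ^ 3 := by
  obtain ⟨x, y, -, -, hxy, hm, hp⟩ := exists_pell_coordinates c
  have hxy' : (x : ℝ) ^ 2 - 3 * y ^ 2 = 1 := by exact_mod_cast hxy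
  rw [paperA, paperD, paperC_eq_of_pow_eq hm hp, paperB_eq_of_pow_eq hm hp]
  linear_combination 351 / 2 * hxy'

theorem stmt_15 :
    StrictMono paperC ∧
      Function.Injective (fun c : ℕ => (paperA c, paperB c, paperC c, paperD c)) ∧
      (∀ c : ℕ, ∃ a b k d : ℤ,
        paperA c = (a : ℝ) ∧ paperB c = (b : ℝ) ∧ paperC c = (k : ℝ) ∧ paperD c = (d : ℝ)) ∧
      (∀ c : ℕ, paperA c ^ 3 + paperB c ^ 3 = paperC c ^ 3 + paperD c ^ 3) := by
  refine ⟨paperC_strictMono, fun c d h => ?_, fun c => ?_, paperA_cube_add_paperB_cube⟩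
  · simp only [Prod.mk.injEq] at h
    exact paperC_strictMono.injective h.2.2.1
  · obtain ⟨k, b, hk, hb⟩ := exists_int_paperC_paperB c
    exact ⟨k + 3, b, k, b + 9, by simp [paperA, hk], hb, hk, by simp [paperD, hb]⟩
end
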